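/- Let C ∈ (ℝ²)*⊗(ℝ²)*⊗ℝ² with det ρ_{s,C} ≠ 0, and suppose M_{a,b}·C = C for some a,b ∈ ℝ with b ≠ 0 and (a,b) ≠ (0,1). Then b = −1, so (M_{a,b})² = Id; moreover M_{a,−1} is conjugate within the group {M_{α,β} : β ≠ 0} to M_{0,−1}, namely M_{α,β}⁻¹ ∘ M_{a,−1} ∘ M_{α,β} = M_{0,−1} when α = a/2 (any β ≠ 0). In particular the isotropy group of C in the shear-dilation group has order at most 2. -/

import Mathlib

open scoped BigOperators
open Matrix

/-- The Ricci matrix `ρ_C` of the Type B connection with Christoffel symbols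
`Γ_{ij}{}^k = C_{ij}{}^k/x¹` (evaluated at `x¹ = 1`; indices are 0-based, so
`C 0 0 0 = C₁₁¹`, etc.). -/
noncomputable def rhoC (C : Fin 2 → Fin 2 → Fin 2 → ℝ) : Matrix (Fin 2) (Fin 2) ℝ :=
  !![(C 0 0 0 - C 0 1 1 + 1) * C 1 0 1 + C 0 0 1 * (C 1 1 1 - C 1 0 0),
     C 1 1 1 + C 0 1 0 * C 1 0 1 - C 0 0 1 * C 1 1 0;
     -C 1 0 0 + C 0 1 0 * C 1 0 1 - C 0 0 1 * C 1 1 0,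
     (C 0 0 0 - C 0 1 1 - 1) * C 1 1 0 + C 0 1 0 * (C 1 1 1 - C 1 0 0)]

/-- The symmetric Ricci matrix `ρ_{s,C} = (ρ_C + ρ_Cᵀ)/2`. -/
noncomputable def rhoS (C : Fin 2 → Fin 2 → Fin 2 → ℝ) : Matrix (Fin 2) (Fin 2) ℝ :=
  (1 / 2 : ℝ) • (rhoC C + (rhoC C)ᵀ)
/-- The shear-dilation matrix `M_{a,b}`, i.e. the linear map with
`M e₁ = e₁ + a e₂` and `M e₂ = b e₂` (corresponding to the coordinate change
`(x¹,x²) ↦ (x¹, a x¹ + b x²)`). -/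
noncomputable def Mab (a b : ℝ) : Matrix (Fin 2) (Fin 2) ℝ := !![1, 0; a, b]

/-- The natural tensor action of an invertible matrix `M` on
`C ∈ (ℝ²)* ⊗ (ℝ²)* ⊗ ℝ²`: the two covariant slots transform by `M⁻¹` and the
contravariant slot by `M`. -/
noncomputable def tensorAct (M : Matrix (Fin 2) (Fin 2) ℝ)
    (C : Fin 2 → Fin 2 → Fin 2 → ℝ) : Fin 2 → Fin 2 → Fin 2 → ℝ :=
  fun i j k => ∑ p : Fin 2, ∑ q : Fin 2, ∑ r : Fin 2,
    M⁻¹ p i * M⁻¹ q j * M k r * C p q r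

theorem Mab_inv (a b : ℝ) (hb : b ≠ 0) : (Mab a b)⁻¹ = !![1, 0; -a / b, 1 / b] := by
  apply Matrix.inv_eq_right_inv
  ext i j
  fin_cases i <;> fin_cases j <;> simp [Mab, Matrix.mul_apply, Fin.sum_univ_two] <;>
    field_simp <;> ring

/-- The Ricci matrix is covariant under the shear-dilation group. -/
theorem rhoC_tensorAct_Mab (C : Fin 2 → Fin 2 → Fin 2 → ℝ) (a b : ℝ) (hb : b ≠ 0) :
    rhoC (tensorAct (Mab a b) C) = ((Mab a b)⁻¹)ᵀ * rhoC C * (Mab a b)⁻¹ := by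
  rw [Matrix.eta_fin_two (((Mab a b)⁻¹)ᵀ * rhoC C * (Mab a b)⁻¹)]
  simp only [rhoC, tensorAct, Mab_inv a b hb]
  congr! 4 <;> simp [Mab, Matrix.mul_apply, Fin.sum_univ_two] <;> field_simp <;> ring

theorem rhoS_tensorAct_Mab (C : Fin 2 → Fin 2 → Fin 2 → ℝ) (a b : ℝ) (hb : b ≠ 0) :
    rhoS (tensorAct (Mab a b) C) = ((Mab a b)⁻¹)ᵀ * rhoS C * (Mab a b)⁻¹ := by
  simp [rhoS, rhoC_tensorAct_Mab C a b hb, Matrix.transpose_mul, Matrix.mul_add,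
    Matrix.add_mul, Matrix.mul_assoc]

theorem det_Mab (a b : ℝ) : (Mab a b).det = b := by
  simp [Mab, Matrix.det_fin_two]

/-- A symmetric matrix invariant under a nontrivial shear is degenerate. -/
theorem det_eq_zero_of_shear_invariant {S : Matrix (Fin 2) (Fin 2) ℝ} (hS : Sᵀ = S) {a : ℝ}
    (ha : a ≠ 0) (h : (Mab a 1)ᵀ * S * Mab a 1 = S) : S.det = 0 := by
  have hsymm : S 1 0 = S 0 1 := congr_fun₂ hS 0 1
  have h00 := congr_fun₂ h 0 0
  have h01 := congr_fun₂ h 0 1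
  simp [Mab, Matrix.mul_apply, Fin.sum_univ_two, hsymm, ha] at h00 h01
  have h2 : S 0 1 = 0 := by
    rw [h01] at h00
    have : a * S 0 1 = 0 := by linarith
    simpa [ha] using this
  rw [Matrix.det_fin_two, hsymm, h01, h2]
  ring

theorem Mab_congr_of_tensorAct_eq {C : Fin 2 → Fin 2 → Fin 2 → ℝ} {a b : ℝ} (hb : b ≠ 0)
    (hfix : tensorAct (Mab a b) C = C) : (Mab a b)ᵀ * rhoS C * Mab a b = rhoS C := by
  have hu : IsUnit (Mab a b).det := by simpa [det_Mab] using hb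
  have h := rhoS_tensorAct_Mab C a b hb
  rw [hfix] at h
  rw [h, Matrix.transpose_nonsing_inv, Matrix.mul_assoc, Matrix.mul_assoc,
    Matrix.nonsing_inv_mul _ hu, Matrix.mul_one, ← Matrix.mul_assoc,
    Matrix.mul_nonsing_inv _ (Matrix.isUnit_det_transpose _ hu), Matrix.one_mul,
    ← Matrix.transpose_nonsing_inv, ← h]

/-- If `det ρ_{s,C} ≠ 0` and `M_{a,b}·C = C` for some `(a,b) ≠ (0,1)` with `b ≠ 0`,
then `b = −1`, so `M_{a,b}` is an involution; moreover `M_{a,−1}` is conjugate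
within the shear-dilation group to `M_{0,−1}` via `M_{a/2,β}` for any `β ≠ 0`.
In particular the isotropy group of `C` in the shear-dilation group has order at
most 2. -/
theorem isotropy_order_two (C : Fin 2 → Fin 2 → Fin 2 → ℝ)
    (hdet : (rhoS C).det ≠ 0) (a b : ℝ) (hb : b ≠ 0)
    (hfix : tensorAct (Mab a b) C = C) (hne : (a, b) ≠ (0, 1)) :
    b = -1 ∧ Mab a b * Mab a b = 1 ∧
      ∀ β : ℝ, β ≠ 0 → (Mab (a / 2) β)⁻¹ * Mab a (-1) * Mab (a / 2) β = Mab 0 (-1) := by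
  have h := Mab_congr_of_tensorAct_eq hb hfix
  have hb1 : b = -1 := by
    have hd := congr_arg Matrix.det h
    simp only [Matrix.det_mul, Matrix.det_transpose, det_Mab] at hd
    have hsq : b ^ 2 = 1 := mul_right_cancel₀ hdet (by linear_combination hd)
    rcases eq_or_eq_neg_of_sq_eq_sq b 1 (by simpa using hsq) with rfl | hneg
    · have ha : a ≠ 0 := fun ha => hne (by rw [ha])
      have hS : (rhoS C)ᵀ = rhoS C := by
        simp [rhoS, add_comm]
      exact absurd (det_eq_zero_of_shear_invariant hS ha h) hdet
    · exact hneg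
  subst hb1
  refine ⟨rfl, ?_, fun β hβ => ?_⟩
  · ext i j
    fin_cases i <;> fin_cases j <;> simp [Mab, Matrix.mul_apply, Fin.sum_univ_two]
  · rw [Mab_inv _ _ hβ]
    ext i j
    fin_cases i <;> fin_cases j <;> simp [Mab, Matrix.mul_apply, Fin.sum_univ_two] <;>
      field_simp <;> ring
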